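/- Let (R, m) be a Noetherian local ring (not necessarily complete) and M a finite R-module of Krull dimension 1. If T is a non-empty proper subset of Assh_R(M) and a is the intersection of all primes p ∈ Assh_R(M) \ T, then Att_R(H^1_a(M)) = T. -/

import Mathlib

/-!
STATEMENT 5 (Dibaei–Jafari, remark after Corollary 2.3): over a (not necessarily complete)
Noetherian local ring, if `dim M = 1` and `T` is a non-empty proper subset of `Assh_R(M)`,
then `Att_R(H^1_a(M)) = T` for `a = ⋂_{p ∈ Assh_R(M) \ T} p`.
-/

open CategoryTheory

noncomputable section

universe u

/-- A prime ideal `p` is an *attached prime* of the `R`-module `N` if `p` is the annihilator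
of some quotient of `N`. -/
def attachedPrimes (R : Type u) [CommRing R] (N : Type u) [AddCommGroup N] [Module R N] :
    Set (Ideal R) :=
  { p | p.IsPrime ∧ ∃ K : Submodule R N, p = Module.annihilator R (N ⧸ K) }

/-- `Assh_R(M)`: the associated primes `p` of `M` with `dim (R ⧸ p) = dim M`, where the
dimension of `M` is recorded by the natural number `n`. -/
def assh (R : Type u) [CommRing R] (M : Type u) [AddCommGroup M] [Module R M] (n : ℕ) :
    Set (Ideal R) :=
  { p ∈ associatedPrimes R M | ringKrullDim (R ⧸ p) = (n : WithBot (WithTop ℕ)) }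

section LinAlg
variable {R : Type u} [CommRing R] {P0 P1 P2 M : Type u} [AddCommGroup P0] [AddCommGroup P1]
  [AddCommGroup P2] [AddCommGroup M] [Module R P0] [Module R P1] [Module R P2] [Module R M]

lemma aux_lift_exists {N K L : Type u} [AddCommGroup N] [AddCommGroup K] [AddCommGroup L]
    [Module R N] [Module R K] [Module R L]
    (d : N →ₗ[R] K) (hd : Function.Surjective d) (f : N →ₗ[R] L)
    (h : ∀ x, d x = 0 → f x = 0) : ∃ g : K →ₗ[R] L, ∀ x, g (d x) = f x := by
  refine ⟨((LinearMap.ker d).liftQ f (fun x hx => h x hx)) ∘ₗ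
    (d.quotKerEquivOfSurjective hd).symm.toLinearMap, fun x => ?_⟩
  have : (d.quotKerEquivOfSurjective hd).symm (d x) = (LinearMap.ker d).mkQ x := by
    rw [LinearEquiv.symm_apply_eq]; rfl
  rw [LinearMap.comp_apply, LinearEquiv.coe_coe, this]
  rfl

lemma aux_lam_exists (I : Ideal R) [Module.Projective R P0] (ε : P0 →ₗ[R] R ⧸ I)
    (d1 : P1 →ₗ[R] P0) (h1 : ∀ x, ε (d1 x) = 0) :
    ∃ (l0 : P0 →ₗ[R] R) (l1 : P1 →ₗ[R] I), (∀ x, Ideal.Quotient.mk I (l0 x) = ε x) ∧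
      ∀ x, (l1 x : R) = l0 (d1 x) := by
  obtain ⟨l0, hl0⟩ := Module.projective_lifting_property I.mkQ ε I.mkQ_surjective
  have h : ∀ x, Ideal.Quotient.mk I (l0 x) = ε x := fun x => LinearMap.congr_fun hl0 x
  refine ⟨l0, (l0 ∘ₗ d1).codRestrict I (fun x => ?_), h, fun x => rfl⟩
  rw [← Ideal.Quotient.eq_zero_iff_mem]
  simp [h, h1]

lemma aux_mu_exists (I : Ideal R) (ε : P0 →ₗ[R] R ⧸ I) (hε : Function.Surjective ε) :
    ∃ mu : R →ₗ[R] P0, ∀ x, ε (mu x) = Ideal.Quotient.mk I x := by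
  obtain ⟨l0, hl0⟩ := Module.projective_lifting_property ε I.mkQ hε
  exact ⟨l0, fun x => LinearMap.congr_fun hl0 x⟩

lemma aux_surj (I : Ideal R) (ε : P0 →ₗ[R] R ⧸ I) (hε : Function.Surjective ε)
    (d1 : P1 →ₗ[R] P0) (d2 : P2 →ₗ[R] P1) (e1 : Function.Exact d1 ε) (e2 : Function.Exact d2 d1)
    (l0 : P0 →ₗ[R] R) (l1 : P1 →ₗ[R] I) (h0 : ∀ x, Ideal.Quotient.mk I (l0 x) = ε x)
    (h1 : ∀ x, (l1 x : R) = l0 (d1 x)) (f : P1 →ₗ[R] M) (hf : ∀ x, f (d2 x) = 0) :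
    ∃ (φ : I →ₗ[R] M) (g : P0 →ₗ[R] M), ∀ x, f x = φ (l1 x) + g (d1 x) := by
  obtain ⟨mu, hmu⟩ := aux_mu_exists I ε hε
  let d1' : P1 →ₗ[R] LinearMap.ker ε := d1.codRestrict _ (fun x => (e1 _).2 ⟨x, rfl⟩)
  have hs : Function.Surjective d1' := by
    rintro ⟨y, hy⟩
    obtain ⟨x, hx⟩ := (e1 _).1 hy
    exact ⟨x, Subtype.ext hx⟩
  obtain ⟨fb, hfb⟩ := aux_lift_exists d1' hs f (by
    intro x hx
    have : d1 x = 0 := congrArg Subtype.val hx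
    obtain ⟨y, rfl⟩ := (e2 _).1 this
    exact hf y)
  let mu' : I →ₗ[R] LinearMap.ker ε := (mu ∘ₗ I.subtype).codRestrict _ (fun x => by
    simp [hmu, Ideal.Quotient.eq_zero_iff_mem])
  let h : P0 →ₗ[R] LinearMap.ker ε := (LinearMap.id - mu ∘ₗ l0).codRestrict _ (fun x => by
    simp [hmu, h0])
  refine ⟨fb ∘ₗ mu', fb ∘ₗ h, fun x => ?_⟩
  rw [← hfb, LinearMap.comp_apply, LinearMap.comp_apply, ← map_add]
  congr 1
  ext
  change d1 x = mu (l1 x : R) + (d1 x - mu (l0 (d1 x)))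
  rw [h1]; abel

lemma aux_ker (I : Ideal R) (ε : P0 →ₗ[R] R ⧸ I) (hε : Function.Surjective ε)
    (d1 : P1 →ₗ[R] P0) (e1 : Function.Exact d1 ε)
    (l0 : P0 →ₗ[R] R) (l1 : P1 →ₗ[R] I) (h0 : ∀ x, Ideal.Quotient.mk I (l0 x) = ε x)
    (h1 : ∀ x, (l1 x : R) = l0 (d1 x)) (φ : I →ₗ[R] M) (g : P0 →ₗ[R] M)
    (h : ∀ x, φ (l1 x) = g (d1 x)) : ∃ m : M, ∀ x : I, φ x = (x : R) • m := by
  obtain ⟨mu, hmu⟩ := aux_mu_exists I ε hε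
  have hi : l0 (mu 1) - 1 ∈ I := by
    rw [← Ideal.Quotient.eq_zero_iff_mem]; simp [h0, hmu]
  refine ⟨g (mu 1) - φ ⟨_, hi⟩, fun x => ?_⟩
  obtain ⟨y, hy⟩ := (e1 (mu (x : R))).1 (by
    rw [hmu]; exact Ideal.Quotient.eq_zero_iff_mem.2 x.2)
  have hmx : mu (x : R) = (x : R) • mu 1 := by rw [← map_smul]; simp
  have hxy : l1 y = x + (x : R) • ⟨l0 (mu 1) - 1, hi⟩ := by
    ext
    simp [h1, hy, hmx]
    ring
  have := h y
  rw [hxy, hy, hmx, map_add, map_smul, map_smul] at this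
  rw [smul_sub, ← this]; abel
end LinAlg

section ExtPart
open Opposite
variable {R : Type u} [CommRing R] 

abbrev FY (M : Type u) [AddCommGroup M] [Module R M] : ModuleCat.{u} R ⥤ (ModuleCat.{u} R)ᵒᵖ :=
  ((linearYoneda R (ModuleCat.{u} R)).obj (ModuleCat.of R M)).rightOp

variable (M : Type u) [AddCommGroup M] [Module R M]

abbrev KP {X : ModuleCat.{u} R} (P : ProjectiveResolution X) :
    ChainComplex (ModuleCat.{u} R)ᵒᵖ ℕ :=
  ((FY M).mapHomologicalComplex _).obj P.complex

/-- precomposition as a map in the opposite category -/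
def kmap {A : Type u} [AddCommGroup A] [Module R A] {X : ModuleCat.{u} R} (l : X →ₗ[R] A) :
    op (ModuleCat.of R (X ⟶ ModuleCat.of R M)) ⟶ op (ModuleCat.of R (A →ₗ[R] M)) :=
  (ModuleCat.ofHom (X := A →ₗ[R] M) (Y := (X ⟶ ModuleCat.of R M))
    { toFun := fun φ => ModuleCat.ofHom (φ ∘ₗ l)
      map_add' := fun _ _ => rfl
      map_smul' := fun _ _ => rfl }).op

lemma kmap_comp {A : Type u} [AddCommGroup A] [Module R A] {X Y : ModuleCat.{u} R}
    (l : X →ₗ[R] A) (d : Y ⟶ X) :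
    (FY M).map d ≫ kmap M l = kmap M (l ∘ₗ d.hom) := rfl

lemma kmap_zero {A : Type u} [AddCommGroup A] [Module R A] {X : ModuleCat.{u} R} :
    kmap M (0 : X →ₗ[R] A) = 0 := by
  apply Quiver.Hom.unop_inj
  ext φ 
  change φ 0 = 0
  simp

variable {M}
lemma pi_surj {X : ModuleCat.{u} R} (P : ProjectiveResolution X) :
    Function.Surjective (P.π.f 0).hom := by
  rw [← ModuleCat.epi_iff_surjective]; infer_instance
lemma exact0 {X : ModuleCat.{u} R} (P : ProjectiveResolution X) :
    Function.Exact (P.complex.d 1 0).hom (P.π.f 0).hom :=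
  (ShortComplex.ShortExact.moduleCat_exact_iff_function_exact _).1 P.exact₀
lemma exact1 {X : ModuleCat.{u} R} (P : ProjectiveResolution X) :
    Function.Exact (P.complex.d 2 1).hom (P.complex.d 1 0).hom :=
  (ShortComplex.ShortExact.moduleCat_exact_iff_function_exact _).1 (P.exact_succ 0)

instance (K : ChainComplex (ModuleCat.{u} R)ᵒᵖ ℕ) : K.HasHomology 1 := inferInstance

lemma pop_inj (K : ChainComplex (ModuleCat.{u} R)ᵒᵖ ℕ) :
    Function.Injective (K.pOpcycles 1).unop.hom := by
  rw [← ModuleCat.mono_iff_injective]; infer_instance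
lemma hi_surj (K : ChainComplex (ModuleCat.{u} R)ᵒᵖ ℕ) :
    Function.Surjective (K.homologyι 1).unop.hom := by
  rw [← ModuleCat.epi_iff_surjective]; infer_instance
lemma hi_exact (K : ChainComplex (ModuleCat.{u} R)ᵒᵖ ℕ) :
    Function.Exact (K.fromOpcycles 1 0).unop.hom (K.homologyι 1).unop.hom := by
  have := ShortComplex.exact_of_f_is_kernel
    (ShortComplex.mk _ _ (K.homologyι_comp_fromOpcycles 1 0)) (K.homologyIsKernel 1 0 (by simp))
  exact (ShortComplex.ShortExact.moduleCat_exact_iff_function_exact _).1 this.unop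


lemma hi_nat {K L : ChainComplex (ModuleCat.{u} R)ᵒᵖ ℕ} (f : K ⟶ L)
    (e : (L.opcycles 1).unop) :
    (HomologicalComplex.homologyMap f 1).unop.hom ((L.homologyι 1).unop.hom e) =
      (K.homologyι 1).unop.hom ((HomologicalComplex.opcyclesMap f 1).unop.hom e) :=
  congrArg (fun f => f.unop.hom e) (HomologicalComplex.homologyι_naturality f 1)

lemma p_nat {K L : ChainComplex (ModuleCat.{u} R)ᵒᵖ ℕ} (f : K ⟶ L)
    (e : (L.opcycles 1).unop) :
    (K.pOpcycles 1).unop.hom ((HomologicalComplex.opcyclesMap f 1).unop.hom e) =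
      (f.f 1).unop.hom ((L.pOpcycles 1).unop.hom e) :=
  congrArg (fun f => f.unop.hom e) (HomologicalComplex.p_opcyclesMap f 1)

variable {I : Ideal R}

def eps (P : ProjectiveResolution (ModuleCat.of R (R ⧸ I))) : P.complex.X 0 →ₗ[R] (R ⧸ I) :=
  (P.π.f 0).hom
lemma eps_surj (P : ProjectiveResolution (ModuleCat.of R (R ⧸ I))) :
    Function.Surjective (eps P) := pi_surj P
lemma eps_exact (P : ProjectiveResolution (ModuleCat.of R (R ⧸ I))) :
    Function.Exact (P.complex.d 1 0).hom (eps P) := exact0 P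

lemma hi_add (K : ChainComplex (ModuleCat.{u} R)ᵒᵖ ℕ) (e e' : (K.opcycles 1).unop)
    (g : (K.X 0).unop) (h : e = e' + (K.fromOpcycles 1 0).unop.hom g) :
    (K.homologyι 1).unop.hom e = (K.homologyι 1).unop.hom e' := by
  rw [h, map_add, (hi_exact K _).2 ⟨_, rfl⟩, add_zero]

structure Lam (P : ProjectiveResolution (ModuleCat.of R (R ⧸ I))) where
  l0 : P.complex.X 0 →ₗ[R] R
  l1 : P.complex.X 1 →ₗ[R] I
  h0 : ∀ x, Ideal.Quotient.mk I (l0 x) = eps P x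
  h1 : ∀ x, (l1 x : R) = l0 ((P.complex.d 1 0).hom x)

lemma lam_nonempty (P : ProjectiveResolution (ModuleCat.of R (R ⧸ I))) : Nonempty (Lam P) := by
  have : Module.Projective R (P.complex.X 0) :=
    (IsProjective.iff_projective _).2 (P.projective 0)
  obtain ⟨l0, l1, h0, h1⟩ := aux_lam_exists I (eps P) (P.complex.d 1 0).hom
    (fun x => (eps_exact P _).2 ⟨x, rfl⟩)
  exact ⟨⟨l0, l1, h0, h1⟩⟩

lemma lam_zero {P : ProjectiveResolution (ModuleCat.of R (R ⧸ I))} (l : Lam P) :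
    l.l1 ∘ₗ (P.complex.d 2 1).hom = 0 := by
  ext x
  change (l.l1 ((P.complex.d 2 1).hom x) : R) = 0
  rw [l.h1, (exact1 P _).2 ⟨x, rfl⟩, map_zero]

variable (M)
def descK {P : ProjectiveResolution (ModuleCat.of R (R ⧸ I))} (l : Lam P) :
    (KP M P).opcycles 1 ⟶ op (ModuleCat.of R (I →ₗ[R] M)) :=
  (KP M P).descOpcycles (kmap M l.l1) 2 (by simp) (by
    refine (kmap_comp M l.l1 (P.complex.d 2 1)).trans ?_
    rw [lam_zero, kmap_zero]
    rfl)

lemma p_descK {P : ProjectiveResolution (ModuleCat.of R (R ⧸ I))} (l : Lam P) :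
    (KP M P).pOpcycles 1 ≫ descK M l = kmap M l.l1 :=
  (KP M P).p_descOpcycles _ _ _ _

def thetaK {P : ProjectiveResolution (ModuleCat.of R (R ⧸ I))} (l : Lam P) :
    (KP M P).homology 1 ⟶ op (ModuleCat.of R (I →ₗ[R] M)) :=
  (KP M P).homologyι 1 ≫ descK M l

lemma p_descK_apply {P : ProjectiveResolution (ModuleCat.of R (R ⧸ I))} (l : Lam P)
    (φ : I →ₗ[R] M) :
    ((KP M P).pOpcycles 1).unop.hom ((descK M l).unop.hom φ) = ModuleCat.ofHom (φ ∘ₗ l.l1) := by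
  have := congrArg (fun f => f.unop.hom φ) (p_descK M l)
  exact this

lemma p_from_apply (P : ProjectiveResolution (ModuleCat.of R (R ⧸ I)))
    (g : P.complex.X 0 ⟶ ModuleCat.of R M) :
    ((KP M P).pOpcycles 1).unop.hom (((KP M P).fromOpcycles 1 0).unop.hom g) =
      P.complex.d 1 0 ≫ g := by
  have := congrArg (fun f => f.unop.hom g) ((KP M P).p_fromOpcycles 1 0)
  exact this

lemma d_p_apply (P : ProjectiveResolution (ModuleCat.of R (R ⧸ I)))
    (e : ((KP M P).opcycles 1).unop) :
    P.complex.d 2 1 ≫ (show P.complex.X 1 ⟶ ModuleCat.of R M from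
      ((KP M P).pOpcycles 1).unop.hom e) = 0 := by
  have := congrArg (fun f => f.unop.hom e) ((KP M P).d_pOpcycles 2 1)
  exact this

lemma thetaK_apply {P : ProjectiveResolution (ModuleCat.of R (R ⧸ I))} (l : Lam P)
    (φ : I →ₗ[R] M) : (thetaK M l).unop.hom φ =
      ((KP M P).homologyι 1).unop.hom ((descK M l).unop.hom φ) := rfl

lemma thetaK_surj {P : ProjectiveResolution (ModuleCat.of R (R ⧸ I))} (l : Lam P) :
    Function.Surjective (thetaK M l).unop.hom := by
  intro e
  obtain ⟨e, rfl⟩ := hi_surj _ e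
  obtain ⟨φ, g, h⟩ := aux_surj I _ (eps_surj P) _ _ (eps_exact P) (exact1 P) l.l0 l.l1 l.h0 l.h1
    (show P.complex.X 1 ⟶ ModuleCat.of R M from ((KP M P).pOpcycles 1).unop.hom e).hom
    (fun x => congrArg (fun f => f.hom x) (d_p_apply M P e))
  refine ⟨φ, ?_⟩
  have key : e = (descK M l).unop.hom φ +
      ((KP M P).fromOpcycles 1 0).unop.hom (ModuleCat.ofHom g) := by
    apply pop_inj
    rw [map_add, p_descK_apply, p_from_apply]
    apply ModuleCat.hom_ext
    ext x
    exact h x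
  rw [thetaK_apply]
  exact (hi_add _ _ _ _ key).symm

lemma thetaK_ker {P : ProjectiveResolution (ModuleCat.of R (R ⧸ I))} (l : Lam P)
    (φ : I →ₗ[R] M) (h : (thetaK M l).unop.hom φ = 0) : ∃ m : M, ∀ x : I, φ x = (x : R) • m := by
  rw [thetaK_apply] at h
  obtain ⟨g, hg⟩ := (hi_exact _ _).1 h
  have := congrArg ((KP M P).pOpcycles 1).unop.hom hg
  rw [p_descK_apply] at this
  have h2 := (p_from_apply M P g).symm.trans this
  exact aux_ker I _ (eps_surj P) _ (eps_exact P) l.l0 l.l1 l.h0 l.h1 φ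
    (show P.complex.X 0 ⟶ ModuleCat.of R M from g).hom
    (fun x => (congrArg (fun f => f.hom x) h2).symm)

/-- a coboundary criterion -/
lemma thetaK_eq {J : Ideal R} {P : ProjectiveResolution (ModuleCat.of R (R ⧸ J))}
    (e e' : ((KP M P).opcycles 1).unop) (g : P.complex.X 0 ⟶ ModuleCat.of R M)
    (h : ((KP M P).pOpcycles 1).unop.hom e = ((KP M P).pOpcycles 1).unop.hom e' +
      (show (((KP M P).X 1).unop : Type u) from P.complex.d 1 0 ≫ g)) :
    ((KP M P).homologyι 1).unop.hom e = ((KP M P).homologyι 1).unop.hom e' := by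
  have key : e = e' + ((KP M P).fromOpcycles 1 0).unop.hom g := by
    apply pop_inj
    rw [map_add, p_from_apply]
    exact h
  exact hi_add _ _ _ _ key

lemma thetaK_nat {J : Ideal R} (hJ : J ≤ I)
    {P : ProjectiveResolution (ModuleCat.of R (R ⧸ J))} (l : Lam P)
    {Q : ProjectiveResolution (ModuleCat.of R (R ⧸ I))} (k : Lam Q)
    (c : P.complex ⟶ Q.complex)
    (comm : c.f 0 ≫ Q.π.f 0 = P.π.f 0 ≫
      ModuleCat.ofHom (Submodule.mapQ J I LinearMap.id hJ)) (φ : I →ₗ[R] M) :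
    (HomologicalComplex.homologyMap (((FY M).mapHomologicalComplex _).map c) 1).unop.hom
      ((thetaK M k).unop.hom φ) =
      (thetaK M l).unop.hom (φ ∘ₗ Submodule.inclusion hJ) := by
  rw [thetaK_apply, thetaK_apply, hi_nat]
  have hmem : ∀ x, k.l0 ((c.f 0).hom x) - l.l0 x ∈ I := by
    intro x
    rw [← Ideal.Quotient.eq_zero_iff_mem, map_sub, k.h0, sub_eq_zero]
    have h2 : eps Q ((c.f 0).hom x) = Submodule.mapQ J I LinearMap.id hJ (eps P x) :=
      congrArg (fun f => f.hom x) comm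
    rw [h2, ← l.h0 x]
    rfl
  let g : P.complex.X 0 →ₗ[R] I := (k.l0 ∘ₗ (c.f 0).hom - l.l0).codRestrict I hmem
  refine thetaK_eq M _ _ (ModuleCat.ofHom (φ ∘ₗ g)) ?_
  rw [p_descK_apply, p_nat, p_descK_apply]
  apply ModuleCat.hom_ext
  ext x
  change φ (k.l1 ((c.f 1).hom x)) = φ (Submodule.inclusion hJ (l.l1 x)) +
    φ (g ((P.complex.d 1 0).hom x))
  rw [← map_add]
  congr 1
  ext
  have h6 := congrArg (fun f => f.hom x) (c.comm 1 0)
  have h7 : (Q.complex.d 1 0).hom ((c.f 1).hom x) = (c.f 0).hom ((P.complex.d 1 0).hom x) := h6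
  change (k.l1 ((c.f 1).hom x) : R) = (l.l1 x : R) +
    (k.l0 ((c.f 0).hom ((P.complex.d 1 0).hom x)) - l.l0 ((P.complex.d 1 0).hom x))
  rw [k.h1, l.h1, h7]
  ring

lemma ext_interface : ∃ θ : ∀ I : Ideal R, (I →ₗ[R] M) →ₗ[R]
      (((Ext R (ModuleCat.{u} R) 1).obj (op (ModuleCat.of R (R ⧸ I)))).obj (ModuleCat.of R M)),
    (∀ I, Function.Surjective (θ I)) ∧
    (∀ I φ, θ I φ = 0 → ∃ m : M, ∀ x : I, φ x = (x : R) • m) ∧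
    (∀ I J (hJ : J ≤ I) φ, (((Ext R (ModuleCat.{u} R) 1).map
      (ModuleCat.ofHom (Submodule.mapQ J I LinearMap.id hJ)).op).app (ModuleCat.of R M)).hom
        (θ I φ) = θ J (φ ∘ₗ Submodule.inclusion hJ)) := by
  let P : ∀ I : Ideal R, ProjectiveResolution (ModuleCat.of R (R ⧸ I)) :=
    fun I => projectiveResolution _
  let l : ∀ I, Lam (P I) := fun I => (lam_nonempty (P I)).some
  let iso : ∀ I : Ideal R, _ ≅ (KP M (P I)).homology 1 :=
    fun I => (P I).isoLeftDerivedObj (FY M) 1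
  refine ⟨fun I => ((iso I).hom ≫ thetaK M (l I)).unop.hom, fun I => ?_, fun I φ h => ?_,
    fun I J hJ φ => ?_⟩
  · exact ((ModuleCat.epi_iff_surjective (iso I).hom.unop).1 inferInstance).comp
      (thetaK_surj M (l I))
  · apply thetaK_ker M (l I) φ
    apply (ModuleCat.mono_iff_injective (iso I).hom.unop).1 inferInstance
    rw [map_zero]
    exact h
  · have comm := ProjectiveResolution.isoLeftDerivedObj_hom_naturality
      (ModuleCat.ofHom (Submodule.mapQ J I LinearMap.id hJ)) (P J) (P I)
      (ProjectiveResolution.lift (ModuleCat.ofHom (Submodule.mapQ J I LinearMap.id hJ))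
        (P J) (P I)) (ProjectiveResolution.lift_commutes_zero _ _ _) (FY M) 1
    have h1 := congrArg (fun f => f.unop.hom ((thetaK M (l I)).unop.hom φ)) comm
    refine h1.trans ?_
    have h2 := thetaK_nat M hJ (l J) (l I)
      (ProjectiveResolution.lift (ModuleCat.ofHom (Submodule.mapQ J I LinearMap.id hJ))
        (P J) (P I)) (ProjectiveResolution.lift_commutes_zero _ _ _) φ
    exact congrArg (iso J).hom.unop.hom h2

end ExtPart

section LC
open Opposite Limits
variable {R : Type u} [CommRing R] (M : Type u) [AddCommGroup M] [Module R M]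

lemma lc_interface (a : Ideal R) :
    ∃ κ : ∀ t : ℕ, ((a ^ t : Ideal R) →ₗ[R] M) →ₗ[R]
        ((localCohomology a 1).obj (ModuleCat.of R M)),
      (∀ y, ∃ t φ, κ t φ = y) ∧
      (∀ t t' (h : t ≤ t') φ, κ t' (φ ∘ₗ Submodule.inclusion (Ideal.pow_le_pow_right h)) = κ t φ) ∧
      (∀ t φ, κ t φ = 0 → ∃ t', ∃ h : t ≤ t', ∃ m : M, ∀ x : (a ^ t' : Ideal R),
        φ (Submodule.inclusion (Ideal.pow_le_pow_right h) x) = (x : R) • m) := by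
  obtain ⟨θ, hs, hk, hn⟩ := ext_interface (R := R) M
  let D := localCohomology.diagram (localCohomology.idealPowersDiagram a) 1
  let ev := (evaluation (ModuleCat.{u} R) (ModuleCat.{u} R)).obj (ModuleCat.of R M)
  let c := ev.mapCocone (colimit.cocone D)
  have hc : IsColimit c := isColimitOfPreserves ev (colimit.isColimit D)
  have : PreservesFilteredColimitsOfSize.{0, 0} (forget (ModuleCat.{u} R)) :=
    preservesFilteredColimitsOfSize_shrink.{0, u, 0, u} _
  have : PreservesColimit (D ⋙ ev) (forget (ModuleCat R)) := inferInstance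
  have hmap : ∀ t t' (h : t ≤ t') φ, ((D ⋙ ev).map (homOfLE h).op.op).hom (θ (a ^ t) φ) =
      θ (a ^ t') (φ ∘ₗ Submodule.inclusion (Ideal.pow_le_pow_right h)) := by
    intro t t' h φ
    exact hn (a ^ t) (a ^ t') (Ideal.pow_le_pow_right h) φ
  refine ⟨fun t => (c.ι.app (op (op t))).hom ∘ₗ θ (a ^ t), ?_, ?_, ?_⟩
  · intro y
    obtain ⟨j, x, hx⟩ := Concrete.isColimit_exists_rep _ hc y
    obtain ⟨φ, rfl⟩ := hs _ x
    exact ⟨j.unop.unop, φ, hx⟩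
  · intro t t' h φ
    have := congrArg (fun f => f.hom (θ (a ^ t) φ)) (c.w (homOfLE h).op.op)
    refine Eq.trans ?_ this
    exact congrArg (c.ι.app (op (op t'))).hom (hmap t t' h φ).symm
  · intro t φ h
    obtain ⟨k, f, g, hfg⟩ := Concrete.isColimit_exists_of_rep_eq (D ⋙ ev) hc
      (i := op (op t)) (j := op (op t)) (θ (a ^ t) φ) 0 (by
        rw [map_zero]; exact h)
    have hle : t ≤ k.unop.unop := leOfHom f.unop.unop
    refine ⟨k.unop.unop, hle, ?_⟩
    refine hk _ (φ ∘ₗ Submodule.inclusion (Ideal.pow_le_pow_right hle)) ?_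
    rw [← hmap _ _ hle]
    have e : f = (homOfLE hle).op.op := rfl
    rw [← e]
    refine hfg.trans ?_
    rw [map_zero]
    rfl
end LC

section AlgPart
variable {R : Type u} [CommRing R] [IsNoetherianRing R]
  {M : Type u} [AddCommGroup M] [Module R M] [Module.Finite R M]

lemma key_false [IsLocalRing R] (p : Ideal R) [p.IsPrime] (s : R)
    (hs : s ∈ IsLocalRing.maximalIdeal R) (hsp : s ∉ p) (hp : Module.annihilator R M ≤ p)
    (h : ∀ m : M, ∃ n : ℕ, ∃ m' : M, ∃ w ∈ p • (⊤ : Submodule R M),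
      s ^ n • m = s ^ (n + 1) • m' + w) : False := by
  let g : ℕ → (M →ₗ[R] M) := fun n => LinearMap.lsmul R M (s ^ n)
  have gap : ∀ n m, g n m = s ^ n • m := fun n m => rfl
  let W : ℕ → Submodule R M := fun n =>
    Submodule.comap (g n) (LinearMap.range (g (n + 1)) ⊔ p • ⊤)
  have hW : ∀ n m, m ∈ W n ↔ ∃ m', ∃ w ∈ p • (⊤ : Submodule R M),
      s ^ n • m = s ^ (n + 1) • m' + w := by
    intro n m
    simp only [W, Submodule.mem_comap, Submodule.mem_sup, LinearMap.mem_range]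
    constructor
    · rintro ⟨_, ⟨m', rfl⟩, w, hw, e⟩
      exact ⟨m', w, hw, e.symm⟩
    · rintro ⟨m', w, hw, e⟩
      exact ⟨_, ⟨m', rfl⟩, w, hw, e.symm⟩
  have hmono : Monotone W := by
    refine monotone_nat_of_le_succ fun n m hm => ?_
    rw [hW] at hm ⊢
    obtain ⟨m', w, hw, e⟩ := hm
    refine ⟨m', s • w, Submodule.smul_mem _ _ hw, ?_⟩
    rw [pow_succ', mul_smul, e, smul_add, ← mul_smul, ← pow_succ']
  obtain ⟨n, hn⟩ := monotone_stabilizes_iff_noetherian.mpr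
    (inferInstance : IsNoetherian R M) ⟨W, hmono⟩
  have htop : ∀ m, m ∈ W n := by
    intro m
    obtain ⟨k, hk⟩ := h m
    have h1 : m ∈ W k := (hW k m).2 hk
    have h2 : m ∈ W (max n k) := hmono (le_max_right _ _) h1
    have h3 : W n = W (max n k) := hn _ (le_max_left _ _)
    rwa [h3]
  have hle : LinearMap.range (g n) ≤ p • (⊤ : Submodule R M) := by
    refine Submodule.le_of_le_smul_of_le_jacobson_bot (I := Ideal.span {s})
      (IsNoetherian.noetherian _) ?_ ?_
    · rw [IsLocalRing.jacobson_eq_maximalIdeal _ bot_ne_top, Ideal.span_singleton_le_iff_mem]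
      exact hs
    · rintro _ ⟨m, rfl⟩
      obtain ⟨m', w, hw, e⟩ := (hW n m).1 (htop m)
      rw [gap, e, add_comm]
      refine Submodule.add_mem_sup hw ?_
      rw [pow_succ', mul_smul]
      exact Submodule.smul_mem_smul (Ideal.mem_span_singleton_self s) ⟨m', rfl⟩
  obtain ⟨q, hq, -, hc, hz⟩ :=
    LinearMap.exists_monic_and_natDegree_eq_and_coeff_mem_pow_and_aeval_eq_zero R (g n) p hle
  have hg : g n = algebraMap R (Module.End R M) (s ^ n) := by
    ext m; rw [gap, Module.algebraMap_end_apply]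
  rw [hg, Polynomial.aeval_algebraMap_apply] at hz
  have hmem : q.eval (s ^ n) ∈ p := by
    apply hp
    rw [Module.mem_annihilator]
    intro m
    have := LinearMap.congr_fun hz m
    simpa [Module.algebraMap_end_apply] using this
  rw [Polynomial.eval_eq_sum_range, Finset.sum_range_succ, hq.coeff_natDegree, one_mul] at hmem
  have h2 : ∑ i ∈ Finset.range q.natDegree, q.coeff i * (s ^ n) ^ i ∈ p := by
    refine Ideal.sum_mem _ fun i hi => Ideal.mul_mem_right _ _ ?_
    have hi := Finset.mem_range.1 hi
    exact Ideal.pow_le_self (by omega) (hc i)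
  have h3 := (Ideal.add_mem_iff_right _ h2).1 hmem
  rw [← pow_mul] at h3
  exact hsp (‹p.IsPrime›.mem_of_pow_mem _ h3)

lemma div_exists (a : Ideal R) (s : R) (hs : s ∈ a)
    (hpow : ∀ k : ℕ, ∃ n : ℕ, a ^ n ≤ Ideal.span {s ^ k} ⊔ Module.annihilator R M)
    (t : ℕ) (φ : (a ^ t : Ideal R) →ₗ[R] M) :
    ∃ n, ∃ h : t ≤ n, ∃ ψ : (a ^ n : Ideal R) →ₗ[R] M, ∀ x,
      s • ψ x = φ (Submodule.inclusion (Ideal.pow_le_pow_right h) x) := by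
  set A := Module.annihilator R M with hA
  obtain ⟨c, hc⟩ := Ideal.exists_pow_inf_eq_pow_smul a (M := R) A
  -- vanishing
  have hvan : ∀ α (hα : α ∈ a ^ t), α ∈ a ^ (t + c) → α ∈ A → φ ⟨α, hα⟩ = 0 := by
    intro α hα h1 h2
    have h3 : α ∈ a ^ (t + c) • (⊤ : Submodule R R) ⊓ A := ⟨by simpa using h1, h2⟩
    rw [hc (t + c) (by omega)] at h3
    have h4 : α ∈ a ^ t • A := by
      rw [Nat.add_sub_cancel] at h3
      exact Submodule.smul_mono le_rfl inf_le_right h3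
    have h5 : ∀ z ∈ a ^ t • A, ∃ hz : z ∈ a ^ t, φ ⟨z, hz⟩ = 0 := by
      intro z hz
      refine Submodule.smul_induction_on (p := fun z => ∃ hz : z ∈ a ^ t, φ ⟨z, hz⟩ = 0) hz ?_ ?_
      · intro r hr y hy
        refine ⟨Ideal.mul_mem_right _ _ hr, ?_⟩
        have : (⟨r • y, Ideal.mul_mem_right _ _ hr⟩ : (a ^ t : Ideal R)) = y • ⟨r, hr⟩ := by
          ext; simp [mul_comm]
        rw [this, map_smul]
        exact Module.mem_annihilator.1 hy _
      · rintro x y ⟨hx, ex⟩ ⟨hy, ey⟩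
        refine ⟨Ideal.add_mem _ hx hy, ?_⟩
        have : (⟨x + y, Ideal.add_mem _ hx hy⟩ : (a ^ t : Ideal R)) = ⟨x, hx⟩ + ⟨y, hy⟩ := rfl
        rw [this, map_add, ex, ey, add_zero]
    exact (h5 α h4).2
  -- stabilization
  let J : ℕ → Ideal R := fun j => Submodule.comap (LinearMap.lsmul R R (s ^ j)) A
  have hJ : ∀ j r, r ∈ J j ↔ s ^ j * r ∈ A := fun j r => Iff.rfl
  have hJm : Monotone J := by
    refine monotone_nat_of_le_succ fun n r hr => ?_
    rw [hJ] at hr ⊢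
    rw [pow_succ', mul_assoc]
    exact Ideal.mul_mem_left _ _ hr
  obtain ⟨j, hj⟩ := monotone_stabilizes_iff_noetherian.mpr
    (inferInstance : IsNoetherian R R) ⟨J, hJm⟩
  let k := t + c + j + 1
  have hjk : ∀ r, s ^ k * r ∈ A → s ^ j * r ∈ A := by
    intro r hr
    have : J j = J k := hj k (by omega)
    rw [← hJ, this, hJ]; exact hr
  have hsm : ∀ i, t ≤ i → s ^ i ∈ a ^ t := fun i hi =>
    Ideal.pow_le_pow_right hi (Ideal.pow_mem_pow hs i)
  let m0 : M := φ ⟨s ^ (t + c), hsm _ (by omega)⟩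
  let B : Ideal R := Ideal.span {s ^ k} ⊔ A
  let d0 : R × A →ₗ[R] R := LinearMap.coprod (LinearMap.lsmul R R (s ^ k)) A.subtype
  have hd0 : ∀ x, d0 x = s ^ k * x.1 + x.2 := fun x => by simp [d0]
  have hd0m : ∀ x, d0 x ∈ B := fun x => by
    rw [hd0]
    exact Submodule.add_mem_sup (Ideal.mul_mem_right _ _ (Ideal.mem_span_singleton_self _)) x.2.2
  obtain ⟨ψ, hψ⟩ := aux_lift_exists (LinearMap.codRestrict B d0 hd0m) (by
      rintro ⟨b, hb⟩
      obtain ⟨y, hy, z, hz, e⟩ := Submodule.mem_sup.1 hb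
      obtain ⟨r, rfl⟩ := Ideal.mem_span_singleton'.1 hy
      refine ⟨(r, ⟨z, hz⟩), ?_⟩
      ext
      rw [LinearMap.codRestrict_apply, hd0]
      exact (by rw [mul_comm] : s ^ k * r + z = r * s ^ k + z).trans e)
    ((LinearMap.toSpanSingleton R M (s ^ j • m0)) ∘ₗ LinearMap.fst R R A) (by
      intro x hx
      have h1 : d0 x = 0 := congrArg Subtype.val hx
      rw [hd0] at h1
      have h2 : s ^ k * x.1 ∈ A := by
        rw [eq_neg_of_add_eq_zero_left h1]; exact A.neg_mem x.2.2
      have h3 := Module.mem_annihilator.1 (hjk _ h2) m0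
      simp only [LinearMap.comp_apply, LinearMap.fst_apply, LinearMap.toSpanSingleton_apply]
      rw [← mul_smul, mul_comm]; exact h3)
  obtain ⟨n, hn⟩ := hpow k
  have hle : a ^ (max n (t + c)) ≤ B := (Ideal.pow_le_pow_right (le_max_left _ _)).trans hn
  have hle2 : t ≤ max n (t + c) := by omega
  refine ⟨max n (t + c), hle2, ψ ∘ₗ Submodule.inclusion hle, ?_⟩
  rintro ⟨x, hx⟩
  obtain ⟨y, hy, α, hα, e⟩ := Submodule.mem_sup.1 (hle hx)
  obtain ⟨r, rfl⟩ := Ideal.mem_span_singleton'.1 hy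
  have e1 : (Submodule.inclusion hle ⟨x, hx⟩) = LinearMap.codRestrict B d0 hd0m (r, ⟨α, hα⟩) := by
    ext
    rw [LinearMap.codRestrict_apply, hd0]
    exact e.symm.trans (by rw [mul_comm])
  rw [LinearMap.comp_apply, e1, hψ]
  have hx' : x ∈ a ^ (t + c) := Ideal.pow_le_pow_right (le_max_right _ _) hx
  have hα' : α ∈ a ^ (t + c) := by
    have : α = x - r * s ^ k := by rw [← e]; ring
    rw [this]
    exact Ideal.sub_mem _ hx' (Ideal.mul_mem_left _ _
      (Ideal.pow_le_pow_right (by omega) (Ideal.pow_mem_pow hs k)))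
  have hαt : α ∈ a ^ t := Ideal.pow_le_pow_right (by omega) hα'
  have e2 : Submodule.inclusion (Ideal.pow_le_pow_right hle2) ⟨x, hx⟩ =
      (r * s ^ (j + 1)) • (⟨s ^ (t + c), hsm _ (by omega)⟩ : (a ^ t : Ideal R)) + ⟨α, hαt⟩ := by
    ext
    simp only [Submodule.coe_inclusion, Submodule.coe_add, Submodule.coe_smul, smul_eq_mul]
    rw [← e]
    simp only [k]; ring
  rw [e2, map_add, map_smul, hvan α hαt hα' hα, add_zero]
  simp only [LinearMap.comp_apply, LinearMap.fst_apply, LinearMap.toSpanSingleton_apply]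
  rw [← mul_smul, ← mul_smul]
  congr 1
  ring

end AlgPart

section AttPart
variable {R : Type u} [CommRing R] [IsNoetherianRing R] [IsLocalRing R]
  {M : Type u} [AddCommGroup M] [Module R M] [Module.Finite R M]

lemma att_eq {N : Type u} [AddCommGroup N] [Module R N] (a : Ideal R) (s : R) (hs : s ∈ a)
    (hsm : s ∈ IsLocalRing.maximalIdeal R)
    (hpow : ∀ k : ℕ, ∃ n : ℕ, a ^ n ≤ Ideal.span {s ^ k} ⊔ Module.annihilator R M)
    (κ : ∀ t : ℕ, ((a ^ t : Ideal R) →ₗ[R] M) →ₗ[R] N)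
    (k1 : ∀ y, ∃ t φ, κ t φ = y)
    (k2 : ∀ t t' (h : t ≤ t') φ,
      κ t' (φ ∘ₗ Submodule.inclusion (Ideal.pow_le_pow_right h)) = κ t φ)
    (k3 : ∀ t φ, κ t φ = 0 → ∃ t', ∃ h : t ≤ t', ∃ m : M, ∀ x : (a ^ t' : Ideal R),
        φ (Submodule.inclusion (Ideal.pow_le_pow_right h) x) = (x : R) • m)
    (T : Set (Ideal R))
    (h1 : ∀ q : Ideal R, q.IsPrime → Module.annihilator R M ≤ q → s ∉ q → q ∈ T)
    (h2 : ∀ p ∈ T, p.IsPrime ∧ Module.annihilator R M ≤ p ∧ s ∉ p ∧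
      ∀ x, x ∉ p → ∃ n : ℕ, s ^ n ∈ Ideal.span {x} ⊔ p) :
    attachedPrimes R N = T := by
  have hann : ∀ r ∈ Module.annihilator R M, ∀ y : N, r • y = 0 := by
    intro r hr y
    obtain ⟨t, φ, rfl⟩ := k1 y
    rw [← map_smul]
    have : r • φ = 0 := by
      ext x
      exact Module.mem_annihilator.1 hr _
    rw [this, map_zero]
  have hsurj : ∀ y : N, ∃ z : N, s • z = y := by
    intro y
    obtain ⟨t, φ, rfl⟩ := k1 y
    obtain ⟨n, hn, ψ, hψ⟩ := div_exists a s hs hpow t φ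
    refine ⟨κ n ψ, ?_⟩
    rw [← map_smul, ← k2 t n hn]
    congr 1
    ext x
    exact hψ x
  have hsurj' : ∀ (n : ℕ) (y : N), ∃ z : N, s ^ n • z = y := by
    intro n
    induction n with
    | zero => intro y; exact ⟨y, by simp⟩
    | succ n ih =>
      intro y
      obtain ⟨z, rfl⟩ := ih y
      obtain ⟨w, rfl⟩ := hsurj z
      exact ⟨w, by rw [pow_succ, mul_smul]⟩
  ext q
  constructor
  · rintro ⟨hq, K, hK⟩
    refine h1 q hq ?_ ?_
    · intro r hr
      rw [hK, Module.mem_annihilator]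
      intro y
      obtain ⟨y, rfl⟩ := Submodule.mkQ_surjective K y
      rw [← map_smul, hann r hr, map_zero]
    · intro hsq
      apply hq.ne_top
      rw [Ideal.eq_top_iff_one, hK, Module.mem_annihilator]
      intro y
      obtain ⟨y, rfl⟩ := Submodule.mkQ_surjective K y
      obtain ⟨z, rfl⟩ := hsurj y
      rw [hK, Module.mem_annihilator] at hsq
      rw [map_smul, hsq, smul_zero]
  · intro hq
    obtain ⟨hp, hA, hsp, hx⟩ := h2 q hq
    refine ⟨hp, q • ⊤, le_antisymm ?_ ?_⟩
    · intro r hr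
      rw [Module.mem_annihilator]
      intro y
      obtain ⟨y, rfl⟩ := Submodule.mkQ_surjective _ y
      rw [← map_smul, Submodule.mkQ_apply, Submodule.Quotient.mk_eq_zero]
      exact Submodule.smul_mem_smul hr trivial
    · intro x hxa
      by_contra hxq
      obtain ⟨n, hn⟩ := hx x hxq
      rw [Module.mem_annihilator] at hxa
      have hxa' : ∀ y : N, x • y ∈ q • (⊤ : Submodule R N) := by
        intro y
        have := hxa (Submodule.mkQ _ y)
        rwa [← map_smul, Submodule.mkQ_apply, Submodule.Quotient.mk_eq_zero] at this
      have htop : ∀ y : N, y ∈ q • (⊤ : Submodule R N) := by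
        intro y
        obtain ⟨z, rfl⟩ := hsurj' n y
        obtain ⟨b, hb, α, hα, e⟩ := Submodule.mem_sup.1 hn
        obtain ⟨r, rfl⟩ := Ideal.mem_span_singleton'.1 hb
        rw [← e, add_smul, mul_smul]
        exact Submodule.add_mem _ (Submodule.smul_mem _ _ (hxa' z))
          (Submodule.smul_mem_smul hα trivial)
      have hrep : ∀ y : N, ∃ t φ, κ t φ = y ∧ ∀ x, φ x ∈ q • (⊤ : Submodule R M) := by
        intro y
        refine Submodule.smul_induction_on (htop y) ?_ ?_
        · intro r hr y _
          obtain ⟨t, φ, rfl⟩ := k1 y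
          exact ⟨t, r • φ, map_smul _ _ _, fun x => Submodule.smul_mem_smul hr trivial⟩
        · rintro y z ⟨t, φ, rfl, hφ⟩ ⟨t', φ', rfl, hφ'⟩
          refine ⟨max t t', φ ∘ₗ Submodule.inclusion (Ideal.pow_le_pow_right (le_max_left _ _)) +
            φ' ∘ₗ Submodule.inclusion (Ideal.pow_le_pow_right (le_max_right _ _)), ?_, ?_⟩
          · rw [map_add, k2 _ _ (le_max_left _ _), k2 _ _ (le_max_right _ _)]
          · intro x
            exact Submodule.add_mem _ (hφ _) (hφ' _)
      refine key_false (M := M) q s hsm hsp hA ?_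
      intro m
      obtain ⟨n, hn, ψ, hψ⟩ := div_exists a s hs hpow 0
        ((LinearMap.toSpanSingleton R M m) ∘ₗ (a ^ 0 : Ideal R).subtype)
      obtain ⟨t, φ, e, hφ⟩ := hrep (κ n ψ)
      have hz : κ (max n t)
          (ψ ∘ₗ Submodule.inclusion (Ideal.pow_le_pow_right (le_max_left n t)) -
           φ ∘ₗ Submodule.inclusion (Ideal.pow_le_pow_right (le_max_right n t))) = 0 := by
        rw [map_sub, k2 _ _ (le_max_left _ _), k2 _ _ (le_max_right _ _), e, sub_self]
      obtain ⟨t', ht', m', hm'⟩ := k3 _ _ hz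
      let σ : (a ^ t' : Ideal R) := ⟨s ^ t', Ideal.pow_mem_pow hs t'⟩
      have e1 := hm' σ
      simp only [LinearMap.sub_apply, LinearMap.comp_apply] at e1
      have e2 := sub_eq_iff_eq_add.1 e1
      have e3 := congrArg (fun z => s • z) e2
      simp only [hψ] at e3
      rw [smul_add] at e3
      refine ⟨t', m', _, Submodule.smul_mem _ s (hφ (Submodule.inclusion
        (Ideal.pow_le_pow_right (le_max_right n t))
        (Submodule.inclusion (Ideal.pow_le_pow_right ht') σ))), Eq.trans ?_ (e3.trans ?_)⟩
      · simp [σ]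
      · rw [← mul_smul, pow_succ']

end AttPart

section DimPart
variable {R : Type u} [CommRing R] [IsLocalRing R]

lemma min_of_dim (I : Ideal R) (hI : ringKrullDim (R ⧸ I) = (1 : WithBot (WithTop ℕ)))
    (q q' : Ideal R) (hq : q.IsPrime) (hq' : q'.IsPrime) (h' : I ≤ q') (h : q' ≤ q)
    (hm : q ≠ IsLocalRing.maximalIdeal R) : q' = q := by
  rw [ringKrullDim_quotient] at hI
  have := Order.krullDim_le_one_iff.1 hI.le
    (⟨⟨q, hq⟩, by simpa [PrimeSpectrum.mem_zeroLocus] using h'.trans h⟩ :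
      PrimeSpectrum.zeroLocus (I : Set R))
  rcases this with h1 | h1
  · refine le_antisymm h (h1 (b := ⟨⟨q', hq'⟩, ?_⟩) h)
    simpa [PrimeSpectrum.mem_zeroLocus] using h'
  · exfalso
    apply hm
    have hqm := IsLocalRing.le_maximalIdeal hq.ne_top
    refine le_antisymm hqm (h1 (b := ⟨⟨IsLocalRing.maximalIdeal R, inferInstance⟩, ?_⟩) hqm)
    simpa [PrimeSpectrum.mem_zeroLocus] using (h'.trans h).trans hqm

lemma dim_eq_one (I : Ideal R) (hI : ringKrullDim (R ⧸ I) = (1 : WithBot (WithTop ℕ)))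
    (q : Ideal R) (hq : q.IsPrime) (h : I ≤ q)
    (hm : q ≠ IsLocalRing.maximalIdeal R) :
    ringKrullDim (R ⧸ q) = (1 : WithBot (WithTop ℕ)) := by
  apply le_antisymm
  · rw [← hI]
    exact ringKrullDim_le_of_surjective (Ideal.Quotient.factor h) (Ideal.Quotient.factor_surjective h)
  · rw [ringKrullDim_quotient]
    have hqm := IsLocalRing.le_maximalIdeal hq.ne_top
    let x : PrimeSpectrum.zeroLocus (q : Set R) :=
      ⟨⟨q, hq⟩, by simp [PrimeSpectrum.mem_zeroLocus]⟩
    let y : PrimeSpectrum.zeroLocus (q : Set R) :=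
      ⟨⟨IsLocalRing.maximalIdeal R, inferInstance⟩, by
        simpa [PrimeSpectrum.mem_zeroLocus] using hqm⟩
    have hxy : x < y := lt_of_le_of_ne hqm (fun e => hm
      (congrArg (fun z : PrimeSpectrum.zeroLocus (q : Set R) => z.1.asIdeal) e))
    exact (Order.le_krullDim_iff (n := 1)).2 ⟨⟨1, ![x, y], fun i => by
      obtain rfl := Subsingleton.elim i 0; simpa using hxy⟩, rfl⟩

lemma dim_max : ringKrullDim (R ⧸ IsLocalRing.maximalIdeal R) = 0 :=
  ringKrullDim_eq_zero_of_isField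
    ((Ideal.Quotient.maximal_ideal_iff_isField_quotient _).1 inferInstance)

end DimPart

theorem stmt5 (R : Type u) [CommRing R] [IsNoetherianRing R] [IsLocalRing R]
    (M : Type u) [AddCommGroup M] [Module R M] [Module.Finite R M]
    (hdim : ringKrullDim (R ⧸ Module.annihilator R M) = (1 : WithBot (WithTop ℕ)))
    (T : Set (Ideal R)) (hT : T ⊆ assh R M 1) (hTne : T.Nonempty)
    (hTproper : T ≠ assh R M 1) :
    attachedPrimes R
      ((localCohomology (sInf (assh R M 1 \ T)) 1).obj (ModuleCat.of R M)) = T := by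
  have hprime : ∀ p ∈ assh R M 1, p.IsPrime := fun p hp => hp.1.1
  have hann : ∀ p ∈ assh R M 1, Module.annihilator R M ≤ p := fun p hp => by
    have := hp.1.annihilator_le
    rwa [Submodule.annihilator_top] at this
  have hnm : ∀ p ∈ assh R M 1, p ≠ IsLocalRing.maximalIdeal R := by
    rintro p hp rfl
    have h1 := hp.2
    rw [dim_max] at h1
    have h2 : (0 : WithBot ℕ∞) = (1 : WithBot ℕ∞) := h1
    exact zero_ne_one h2
  have hmem : ∀ q : Ideal R, q.IsPrime → Module.annihilator R M ≤ q →
      q ≠ IsLocalRing.maximalIdeal R → q ∈ assh R M 1 := by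
    intro q hq hA hm
    refine ⟨?_, ?_⟩
    · apply Module.associatedPrimes.minimalPrimes_annihilator_subset_associatedPrimes R M
      refine ⟨⟨hq, hA⟩, ?_⟩
      rintro q' ⟨hq', hA'⟩ hle
      exact (min_of_dim _ hdim q q' hq hq' hA' hle hm).ge
    · rw [dim_eq_one _ hdim q hq hA hm]; rfl
  have hfin : (assh R M 1).Finite := (associatedPrimes.finite R M).subset (fun p hp => hp.1)
  set a := sInf (assh R M 1 \ T) with ha
  have hfinc : (assh R M 1 \ T).Finite := hfin.subset Set.sdiff_subset
  have hnec : (assh R M 1 \ T).Nonempty := by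
    rw [Set.nonempty_iff_ne_empty]
    intro h
    exact hTproper (hT.antisymm (Set.sdiff_eq_empty.1 h))
  have hale : ∀ q : Ideal R, q.IsPrime → a ≤ q → ∃ p ∈ assh R M 1 \ T, p ≤ q := by
    intro q hq hle
    have : hfinc.toFinset.inf id = a := by
      rw [Finset.inf_id_eq_sInf, Set.Finite.coe_toFinset]
    rw [← this, hq.inf_le'] at hle
    obtain ⟨p, hp, hpq⟩ := hle
    exact ⟨p, by simpa using hp, hpq⟩
  have hnot : ∀ p ∈ T, ¬ a ≤ p := by
    intro p hp hle
    obtain ⟨p', hp', hpp⟩ := hale p (hprime p (hT hp)) hle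
    have := min_of_dim _ hdim p p' (hprime p (hT hp)) (hprime p' hp'.1) (hann p' hp'.1) hpp
      (hnm p (hT hp))
    exact hp'.2 (this ▸ hp)
  obtain ⟨s, hs, hsT⟩ : ∃ s ∈ a, ∀ p ∈ T, s ∉ p := by
    by_contra hcon
    push Not at hcon
    obtain ⟨p, hp, hle⟩ := (Ideal.subset_union_prime_finite (hfin.subset hT) (f := id) ⊥ ⊥
      (fun i hi _ _ => hprime i (hT hi)) (I := a)).1 (by
        intro x hx
        obtain ⟨p, hp, hxp⟩ := hcon x hx
        exact Set.mem_biUnion hp hxp)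
    exact hnot p hp hle
  have ham : a ≤ IsLocalRing.maximalIdeal R := by
    obtain ⟨p, hp⟩ := hnec
    exact (sInf_le hp).trans (IsLocalRing.le_maximalIdeal (hprime p hp.1).ne_top)
  have hpow : ∀ k : ℕ, ∃ n : ℕ, a ^ n ≤ Ideal.span {s ^ k} ⊔ Module.annihilator R M := by
    intro k
    refine Ideal.exists_pow_le_of_le_radical_of_fg ?_ (IsNoetherian.noetherian _)
    rw [Ideal.radical_eq_sInf]
    refine le_sInf ?_
    rintro q ⟨hle, hq⟩
    by_cases hm : q = IsLocalRing.maximalIdeal R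
    · rw [hm]; exact ham
    · have hA : Module.annihilator R M ≤ q := le_sup_right.trans hle
      have hsq : s ∈ q := hq.mem_of_pow_mem k
        (hle (Ideal.mem_sup_left (Ideal.mem_span_singleton_self _)))
      exact sInf_le ⟨hmem q hq hA hm, fun hqT => hsT q hqT hsq⟩
  obtain ⟨κ, k1, k2, k3⟩ := lc_interface (R := R) M a
  refine att_eq (M := M) a s hs (ham hs) hpow κ k1 k2 k3 T ?_ ?_
  · intro q hq hA hsq
    by_contra hqT
    have hm : q ≠ IsLocalRing.maximalIdeal R := fun e => hsq (e ▸ ham hs)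
    exact hsq ((sInf_le (⟨hmem q hq hA hm, hqT⟩ : q ∈ assh R M 1 \ T) : a ≤ q) hs)
  · intro p hp
    have hp1 := hprime p (hT hp)
    have hpA := hann p (hT hp)
    refine ⟨hp1, hpA, hsT p hp, ?_⟩
    intro x hx
    have : s ∈ (Ideal.span {x} ⊔ p).radical := by
      rw [Ideal.radical_eq_sInf, Ideal.mem_sInf]
      rintro q ⟨hle, hq⟩
      by_cases hm : q = IsLocalRing.maximalIdeal R
      · rw [hm]; exact ham hs
      · exfalso
        have := min_of_dim _ hdim q p hq hp1 hpA (le_sup_right.trans hle) hm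
        apply hx
        rw [this]
        exact hle (Ideal.mem_sup_left (Ideal.mem_span_singleton_self _))
    exact this

end
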